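/- Let G be a finitely generated solvable group with ω(G) = 1 (zero algebraic entropy). Then G contains a nilpotent subgroup of finite index. -/

import Mathlib

section GrowthDefs

variable {G : Type*} [Group G]

/-- The ball of radius `n` w.r.t. a finite set `X`: all elements of `G` that are products
of at most `n` letters from `X ∪ X⁻¹`. -/
def wordBall (X : Finset G) (n : ℕ) : Set G :=
  {g | ∃ l : List G, l.length ≤ n ∧ (∀ x ∈ l, x ∈ X ∨ x⁻¹ ∈ X) ∧ l.prod = g}

/-- The growth function `γ_G^X(n) = card {g ∈ G : ‖g‖_X ≤ n}`. -/
noncomputable def growthFn (X : Finset G) (n : ℕ) : ℕ :=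
  Nat.card (wordBall X n)

/-- The exponential growth rate `ω(G,X) = lim_{n→∞} γ_G^X(n)^{1/n}`, which by
submultiplicativity of the growth function equals `inf_{n ≥ 1} γ_G^X(n)^{1/n}`. -/
noncomputable def growthRateX (X : Finset G) : ℝ :=
  ⨅ n : ℕ, (growthFn X (n + 1) : ℝ) ^ ((1 : ℝ) / (n + 1))

/-- The minimal exponential growth rate `ω(G) = inf_X ω(G,X)`, the infimum being taken
over all finite generating sets `X` of `G`. -/
noncomputable def minGrowthRate (G : Type*) [Group G] : ℝ :=
  sInf {r : ℝ | ∃ X : Finset G, Subgroup.closure (X : Set G) = ⊤ ∧ r = growthRateX X}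

/-- `G` has exponential growth: `ω(G,X) > 1` for some (equivalently, every) finite
generating set `X`. -/
def HasExponentialGrowth (G : Type*) [Group G] : Prop :=
  ∃ X : Finset G, Subgroup.closure (X : Set G) = ⊤ ∧ 1 < growthRateX X

end GrowthDefs

open scoped commutatorElement

open Subgroup in
theorem Subgroup.lowerCentralSeries_mono_of_le {G : Type*} [Group G] {H K : Subgroup G}
    (h : H ≤ K) (n : ℕ) : H.lowerCentralSeries n ≤ K.lowerCentralSeries n := by
  induction n with
  | zero => exact h
  | succ n ih => exact commutator_mono ih h

open Subgroup in
theorem Subgroup.lowerCentralSeries_comap_le {G K : Type*} [Group G] [Group K] (f : G →* K)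
    (H : Subgroup K) (n : ℕ) :
    (H.comap f).lowerCentralSeries n ≤ (H.lowerCentralSeries n).comap f := by
  rw [← map_le_iff_le_comap, map_lowerCentralSeries]
  exact lowerCentralSeries_mono_of_le (map_comap_le _ _) n

/-- The left-normed commutators of weight `n + 1` in the elements of `X`. -/
def leftNormedCommutators {G : Type*} [Group G] (X : Set G) : ℕ → Set G
  | 0 => X
  | n + 1 => Set.image2 (fun y x => ⁅y, x⁆) (leftNormedCommutators X n) X

theorem leftNormedCommutators_finite {G : Type*} [Group G] {X : Set G} (hX : X.Finite) (n : ℕ) :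
    (leftNormedCommutators X n).Finite := by
  induction n with
  | zero => exact hX
  | succ n ih => exact ih.image2 _ hX

theorem leftNormedCommutators_subset {G : Type*} [Group G] {X : Set G} {H : Subgroup G}
    (hX : X ⊆ H) (n : ℕ) : leftNormedCommutators X n ⊆ H.lowerCentralSeries n := by
  induction n with
  | zero => exact hX
  | succ n ih =>
    rintro _ ⟨y, hy, x, hx, rfl⟩
    exact Subgroup.commutator_mem_commutator (ih hy) (hX hx)

open Subgroup in
/-- The lower central series of a normal subgroup is generated, as a sequence of normal subgroups,
by the left-normed commutators of a generating set. -/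
theorem lowerCentralSeries_le_of_leftNormedCommutators {G : Type*} [Group G] {X : Set G}
    {H : Subgroup G} (hH : H.Normal) (hX : closure X = H) (n : ℕ) (N : Subgroup G)
    (hN : N.Normal) (h : leftNormedCommutators X n ⊆ N) : H.lowerCentralSeries n ≤ N := by
  induction n generalizing N with
  | zero => rw [← hX] at *; exact (closure_le _).2 h
  | succ n ih =>
    have hHq : (H.map (QuotientGroup.mk' N)).Normal :=
      hH.map _ (QuotientGroup.mk'_surjective N)
    have key := ih ((centralizer (H.map (QuotientGroup.mk' N) : Set (G ⧸ N))).comap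
      (QuotientGroup.mk' N)) inferInstance ?_
    · rw [Subgroup.lowerCentralSeries_succ, commutator_le]
      intro y hy x hx
      have h1 := mem_centralizer_iff.1 (key hy) _ (mem_map_of_mem _ hx)
      rw [← QuotientGroup.eq_one_iff]
      change (QuotientGroup.mk' N) ⁅y, x⁆ = 1
      rw [map_commutatorElement, commutatorElement_eq_one_iff_mul_comm]
      exact h1.symm
    · intro y hy
      rw [SetLike.mem_coe, mem_comap, ← hX, MonoidHom.map_closure, centralizer_closure,
        mem_centralizer_iff]
      rintro _ ⟨x, hx, rfl⟩
      have : ⁅y, x⁆ ∈ N := h ⟨y, hy, x, hx, rfl⟩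
      rw [← QuotientGroup.eq_one_iff] at this
      change (QuotientGroup.mk' N) ⁅y, x⁆ = 1 at this
      rw [map_commutatorElement, commutatorElement_eq_one_iff_mul_comm] at this
      exact this.symm

/-- The quotient of `G` by (the normal subgroup) `M` is virtually nilpotent. -/
def IsVirtNilpotentMod {G : Type*} [Group G] (M : Subgroup G) : Prop :=
  ∃ H : Subgroup G, H.Normal ∧ H.FiniteIndex ∧ ∃ n, H.lowerCentralSeries n ≤ M

theorem isVirtNilpotentMod_of_finiteIndex {G : Type*} [Group G] {M : Subgroup G} (H : Subgroup G)
    (hH : H.FiniteIndex) (n : ℕ) (h : H.lowerCentralSeries n ≤ M) : IsVirtNilpotentMod M :=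
  ⟨H.normalCore, inferInstance, inferInstance, n,
    (Subgroup.lowerCentralSeries_mono_of_le H.normalCore_le n).trans h⟩

theorem IsVirtNilpotentMod.comap {G K : Type*} [Group G] [Group K] (f : G →* K) {M : Subgroup K}
    (h : IsVirtNilpotentMod M) : IsVirtNilpotentMod (M.comap f) := by
  obtain ⟨H, h1, h2, n, h3⟩ := h
  have hfi : (H.comap f).FiniteIndex := ⟨by
    rw [Subgroup.index_comap]
    exact (inferInstance : (H.subgroupOf f.range).FiniteIndex).index_ne_zero⟩
  exact ⟨H.comap f, inferInstance, hfi, n,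
    (Subgroup.lowerCentralSeries_comap_le f H n).trans (Subgroup.comap_mono h3)⟩

theorem IsVirtNilpotentMod.map {G K : Type*} [Group G] [Group K] {f : G →* K}
    (hf : Function.Surjective f) {M : Subgroup G}
    (h : IsVirtNilpotentMod M) : IsVirtNilpotentMod (M.map f) := by
  obtain ⟨H, h1, h2, n, h3⟩ := h
  refine ⟨H.map f, h1.map f hf, ⟨?_⟩, n, ?_⟩
  · exact ne_zero_of_dvd_ne_zero h2.index_ne_zero (H.index_map_dvd hf)
  · rw [← Subgroup.map_lowerCentralSeries]
    exact Subgroup.map_mono h3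

open Subgroup in
theorem isVirtNilpotentMod_bot_of_subgroup {G : Type*} [Group G] (K : Subgroup G)
    (hK : K.FiniteIndex) (h : IsVirtNilpotentMod (⊥ : Subgroup K)) :
    IsVirtNilpotentMod (⊥ : Subgroup G) := by
  obtain ⟨H, -, h2, n, h3⟩ := h
  refine isVirtNilpotentMod_of_finiteIndex (H.map K.subtype) ⟨?_⟩ n ?_
  · rw [index_map_subtype]
    exact mul_ne_zero h2.index_ne_zero hK.index_ne_zero
  · rw [← map_lowerCentralSeries, le_bot_iff.1 h3, Subgroup.map_bot]

open Subgroup in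
/-- A finitely generated group that is not virtually nilpotent has a quotient which is not
virtually nilpotent while all its proper quotients are. -/
theorem exists_just_non_virtNilpotent {G : Type*} [Group G] (hG : Group.FG G)
    (h : ¬ IsVirtNilpotentMod (⊥ : Subgroup G)) :
    ∃ N : Subgroup G, N.Normal ∧ ¬ IsVirtNilpotentMod N ∧
      ∀ M : Subgroup G, M.Normal → N < M → IsVirtNilpotentMod M := by
  obtain ⟨N, -, hN⟩ := zorn_le_nonempty₀
    {N : Subgroup G | N.Normal ∧ ¬ IsVirtNilpotentMod N} (by
      intro c hc hchain y hy
      have hd : DirectedOn (· ≤ ·) c := hchain.directedOn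
      have hsup : ∀ s : Set G, s.Finite → s ⊆ (sSup c : Subgroup G) → ∃ N ∈ c, s ⊆ N := by
        intro s hs
        induction s, hs using Set.Finite.induction_on with
        | empty => exact fun _ => ⟨y, hy, Set.empty_subset _⟩
        | insert _ _ ih =>
          intro hs
          obtain ⟨N, hN, hsN⟩ := ih ((Set.subset_insert _ _).trans hs)
          obtain ⟨N', hN', haN⟩ := (mem_sSup_of_directedOn ⟨y, hy⟩ hd).1
            (hs (Set.mem_insert _ _))
          obtain ⟨P, hP, h1, h2⟩ := hd N hN N' hN'
          exact ⟨P, hP, Set.insert_subset (h2 haN) (hsN.trans h1)⟩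
      refine ⟨sSup c, ⟨⟨fun n hn g => ?_⟩, ?_⟩, fun z hz => le_sSup hz⟩
      · obtain ⟨N, hN, hnN⟩ := (mem_sSup_of_directedOn ⟨y, hy⟩ hd).1 hn
        exact le_sSup hN ((hc hN).1.conj_mem n hnN g)
      · rintro ⟨H, h1, h2, n, h3⟩
        have hHfg : Group.FG H := inferInstance
        obtain ⟨S, hS, hSf⟩ := (Subgroup.fg_iff H).1 ((Group.fg_iff_subgroup_fg H).1 hHfg)
        have hSH : S ⊆ H := by rw [← hS]; exact subset_closure
        obtain ⟨N, hN, hsN⟩ := hsup _ (leftNormedCommutators_finite hSf n)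
          ((leftNormedCommutators_subset hSH n).trans h3)
        exact (hc hN).2 ⟨H, h1, h2, n,
          lowerCentralSeries_le_of_leftNormedCommutators h1 hS n N (hc hN).1 hsN⟩)
    ⊥ ⟨inferInstance, h⟩
  refine ⟨N, hN.prop.1, hN.prop.2, fun M hM hlt => ?_⟩
  by_contra hcon
  exact hlt.not_ge (hN.le_of_ge ⟨hM, hcon⟩ hlt.le)

open Subgroup in
/-- An endomorphism of a normal subgroup that commutes with conjugation: if `G` is virtually
nilpotent modulo its kernel and modulo its range then `G` is virtually nilpotent. -/
theorem isVirtNilpotentMod_bot_of_ker_of_range {G : Type*} [Group G] {A : Subgroup G}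
    (hA : A.Normal) (f : A →* A) (hf : ∀ (g : G) (a : A), f (MulAut.conjNormal g a) =
      MulAut.conjNormal g (f a)) (h1 : IsVirtNilpotentMod (f.ker.map A.subtype))
    (h2 : IsVirtNilpotentMod (f.range.map A.subtype)) : IsVirtNilpotentMod (⊥ : Subgroup G) := by
  obtain ⟨H₁, hn₁, hi₁, n₁, h1⟩ := h1
  obtain ⟨H₂, hn₂, hi₂, n₂, h2⟩ := h2
  set H := H₁ ⊓ H₂
  have hH : H.Normal := inferInstance
  replace h1 := (lowerCentralSeries_mono_of_le (inf_le_left : H ≤ H₁) n₁).trans h1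
  replace h2 := (lowerCentralSeries_mono_of_le (inf_le_right : H ≤ H₂) n₂).trans h2
  let D : ℕ → Subgroup G := fun n => Nat.rec A (fun _ B => ⁅B, H⁆) n
  have hD : ∀ j, D (j + 1) ≤ H.lowerCentralSeries j := by
    intro j
    induction j with
    | zero => exact commutator_le_right A H
    | succ j ih => exact commutator_mono ih le_rfl
  have hγ : ∀ j, ∀ y ∈ H.lowerCentralSeries (n₂ + j),
      ∃ a : A, (a : G) ∈ D j ∧ (f a : G) = y := by
    intro j
    induction j with
    | zero =>
      intro y hy
      obtain ⟨_, ⟨a, rfl⟩, rfl⟩ := h2 hy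
      exact ⟨a, a.2, rfl⟩
    | succ j ih =>
      have : H.lowerCentralSeries (n₂ + (j + 1)) ≤
          (((D (j + 1)).subgroupOf A).map f).map A.subtype := by
        rw [← add_assoc, Subgroup.lowerCentralSeries_succ, commutator_le]
        intro y hy h hh
        obtain ⟨a, ha, rfl⟩ := ih y hy
        refine ⟨f (a * MulAut.conjNormal h a⁻¹), ⟨a * MulAut.conjNormal h a⁻¹, ?_, rfl⟩, ?_⟩
        · have : ⁅(a : G), h⁆ ∈ D (j + 1) := commutator_mem_commutator ha hh
          rw [SetLike.mem_coe, mem_subgroupOf]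
          convert this using 1
          simp [commutatorElement_def, mul_assoc]
        · rw [map_mul, hf]
          simp [commutatorElement_def, mul_assoc]
      intro y hy
      obtain ⟨_, ⟨a, ha, rfl⟩, rfl⟩ := this hy
      exact ⟨a, ha, rfl⟩
  refine ⟨H, hH, inferInstance, n₂ + (n₁ + 1), fun y hy => ?_⟩
  obtain ⟨a, ha, rfl⟩ := hγ _ y hy
  obtain ⟨b, hb, hba⟩ := h1 (hD _ ha)
  obtain rfl : b = a := Subtype.ext hba
  rw [mem_bot, MonoidHom.mem_ker.1 hb, OneMemClass.coe_one]

open Subgroup in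
/-- In a finitely generated group with finite `c`-th lower central term, some subgroup of finite
index has trivial `c`-th lower central term. -/
theorem exists_finiteIndex_lowerCentralSeries_eq_bot {G : Type*} [Group G] (hG : Group.FG G)
    (c : ℕ) (hfin : ((⊤ : Subgroup G).lowerCentralSeries c : Set G).Finite) :
    ∃ K : Subgroup G, K.Normal ∧ K.FiniteIndex ∧ K.lowerCentralSeries c = ⊥ := by
  cases c with
  | zero =>
    have : Finite G := Set.finite_univ_iff.1 (by simpa using hfin)
    exact ⟨⊥, inferInstance, inferInstance, rfl⟩
  | succ m =>
    obtain ⟨X, hX, hXf⟩ := Group.fg_iff.1 hG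
    have hCf := leftNormedCommutators_finite hXf m
    have hcent : ∀ y ∈ leftNormedCommutators X m, (centralizer {y}).FiniteIndex := by
      intro y hy
      have hy' := leftNormedCommutators_subset (H := ⊤) (by simp) m hy
      have hT : Finite ((⊤ : Subgroup G).lowerCentralSeries (m + 1)) := hfin
      rw [finiteIndex_iff_finite_quotient]
      refine Finite.of_injective (β := (⊤ : Subgroup G).lowerCentralSeries (m + 1))
        (Quotient.lift (fun g : G => ⟨⁅y, g⁆, commutator_mem_commutator hy' (mem_top g)⟩) ?_) ?_
      · intro a b hab
        have hab' : a⁻¹ * b ∈ centralizer {y} := QuotientGroup.leftRel_apply.1 hab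
        rw [mem_centralizer_singleton_iff] at hab'
        refine Subtype.ext ?_
        change y * a * y⁻¹ * a⁻¹ = y * b * y⁻¹ * b⁻¹
        rw [mul_assoc, mul_assoc, mul_assoc y b, mul_assoc y, mul_right_inj]
        have : b * y⁻¹ * b⁻¹ = a * ((a⁻¹ * b) * y⁻¹ * (a⁻¹ * b)⁻¹) * a⁻¹ := by group
        rw [← mul_assoc a, this]
        have : (a⁻¹ * b) * y⁻¹ = y⁻¹ * (a⁻¹ * b) := by
          rw [mul_inv_eq_iff_eq_mul, mul_assoc, hab', inv_mul_cancel_left]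
        rw [this]; group
      · rintro ⟨a⟩ ⟨b⟩ hab
        refine QuotientGroup.eq.2 (mem_centralizer_singleton_iff.2 ?_)
        have hab' : y * a * y⁻¹ * a⁻¹ = y * b * y⁻¹ * b⁻¹ := congrArg Subtype.val hab
        rw [mul_assoc, mul_assoc, mul_assoc y b, mul_assoc y, mul_right_inj] at hab'
        have h3 : a * y⁻¹ * a⁻¹ = b * y⁻¹ * b⁻¹ := by simpa [mul_assoc] using hab'
        have h4 : a * y * a⁻¹ = b * y * b⁻¹ := by
          have := congrArg (·⁻¹) h3
          simpa [mul_assoc] using this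
        calc a⁻¹ * b * y = a⁻¹ * (b * y * b⁻¹) * b := by group
          _ = y * (a⁻¹ * b) := by rw [← h4]; group
    set K₀ : Subgroup G := ⨅ y : leftNormedCommutators X m, centralizer {(y : G)}
    have hK₀ : K₀.FiniteIndex := by
      have : Finite (leftNormedCommutators X m) := hCf
      exact finiteIndex_iInf fun y => hcent y y.2
    refine ⟨K₀.normalCore, inferInstance, inferInstance, ?_⟩
    have hle : (⊤ : Subgroup G).lowerCentralSeries m ≤ centralizer (K₀.normalCore : Set G) := by
      refine lowerCentralSeries_le_of_leftNormedCommutators inferInstance hX m _ inferInstance ?_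
      intro y hy
      refine mem_centralizer_iff.2 fun k hk => ?_
      have := (mem_iInf.1 (K₀.normalCore_le hk)) ⟨y, hy⟩
      exact mem_centralizer_singleton_iff.1 this
    rw [Subgroup.lowerCentralSeries_succ, commutator_eq_bot_iff_le_centralizer]
    exact (lowerCentralSeries_mono_of_le le_top m).trans hle

theorem one_mem_wordBall {G : Type*} [Group G] (X : Finset G) (n : ℕ) : 1 ∈ wordBall X n :=
  ⟨[], by simp, by simp, rfl⟩

theorem mem_wordBall_one {G : Type*} [Group G] {X : Finset G} {x : G} (hx : x ∈ X) :
    x ∈ wordBall X 1 :=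
  ⟨[x], by simp, by simpa using Or.inl hx, by simp⟩

theorem wordBall_mono {G : Type*} [Group G] (X : Finset G) {m n : ℕ} (h : m ≤ n) :
    wordBall X m ⊆ wordBall X n := by
  rintro g ⟨l, hl, h1, h2⟩
  exact ⟨l, hl.trans h, h1, h2⟩

theorem mul_mem_wordBall {G : Type*} [Group G] {X : Finset G} {m n : ℕ} {g h : G}
    (hg : g ∈ wordBall X m) (hh : h ∈ wordBall X n) : g * h ∈ wordBall X (m + n) := by
  obtain ⟨l, hl, h1, rfl⟩ := hg
  obtain ⟨l', hl', h1', rfl⟩ := hh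
  refine ⟨l ++ l', by simp; omega, fun x hx => ?_, by simp⟩
  rcases List.mem_append.1 hx with hx | hx
  exacts [h1 x hx, h1' x hx]

theorem inv_mem_wordBall {G : Type*} [Group G] {X : Finset G} {n : ℕ} {g : G}
    (hg : g ∈ wordBall X n) : g⁻¹ ∈ wordBall X n := by
  obtain ⟨l, hl, h1, rfl⟩ := hg
  refine ⟨(l.map (·⁻¹)).reverse, by simpa using hl, fun x hx => ?_,
    (List.prod_inv_reverse l).symm⟩
  obtain ⟨y, hy, rfl⟩ := List.mem_map.1 (List.mem_reverse.1 hx)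
  simpa [or_comm] using h1 y hy

theorem pow_mem_wordBall {G : Type*} [Group G] {X : Finset G} {n : ℕ} {g : G}
    (hg : g ∈ wordBall X n) (k : ℕ) : g ^ k ∈ wordBall X (k * n) := by
  induction k with
  | zero => simpa using one_mem_wordBall X _
  | succ k ih => rw [pow_succ, add_mul, one_mul]; exact mul_mem_wordBall ih hg

/-- Products of at most `n` letters, each in the ball of radius `m`. -/
theorem list_prod_mem_wordBall {G : Type*} [Group G] {X : Finset G} {m : ℕ} (l : List G)
    (h : ∀ x ∈ l, x ∈ wordBall X m) : l.prod ∈ wordBall X (m * l.length) := by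
  induction l with
  | nil => simpa using one_mem_wordBall X _
  | cons x l ih =>
    rw [List.prod_cons, List.length_cons, mul_add, mul_one, add_comm]
    exact mul_mem_wordBall (h x (by simp)) (ih fun y hy => h y (by simp [hy]))

theorem wordBall_add {G : Type*} [Group G] (X : Finset G) (m n : ℕ) {g : G}
    (hg : g ∈ wordBall X (m + n)) : ∃ a ∈ wordBall X m, ∃ b ∈ wordBall X n, a * b = g := by
  obtain ⟨l, hl, h1, rfl⟩ := hg
  exact ⟨(l.take m).prod, ⟨l.take m, by simp, fun x hx => h1 x (List.mem_of_mem_take hx), rfl⟩,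
    (l.drop m).prod, ⟨l.drop m, by simp; omega, fun x hx => h1 x (List.mem_of_mem_drop hx), rfl⟩,
    List.prod_take_mul_prod_drop l m⟩

theorem wordBall_finite {G : Type*} [Group G] (X : Finset G) (n : ℕ) : (wordBall X n).Finite := by
  induction n with
  | zero =>
    refine (Set.finite_singleton (1 : G)).subset ?_
    rintro g ⟨l, hl, -, rfl⟩
    simp [List.length_eq_zero_iff.1 (Nat.le_zero.1 hl)]
  | succ n ih =>
    have h1 : (wordBall X 1).Finite := by
      classical
      refine ((X ∪ X.image (·⁻¹) ∪ {1}).finite_toSet).subset ?_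
      rintro g ⟨l, hl, h1, rfl⟩
      match l with
      | [] => simp
      | [x] =>
        have := h1 x (by simp)
        simpa using Or.inr this
    refine (ih.image2 (· * ·) h1).subset fun g hg => ?_
    obtain ⟨a, ha, b, hb, h⟩ := wordBall_add X n 1 hg
    exact ⟨a, ha, b, hb, h⟩

theorem mem_wordBall_of_closure {G : Type*} [Group G] {X : Finset G}
    (hX : Subgroup.closure (X : Set G) = ⊤) (g : G) : ∃ n, g ∈ wordBall X n := by
  have hg : g ∈ Subgroup.closure (X : Set G) := hX ▸ Subgroup.mem_top g
  induction hg using Subgroup.closure_induction with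
  | mem x hx => exact ⟨1, mem_wordBall_one hx⟩
  | one => exact ⟨0, one_mem_wordBall X 0⟩
  | mul x y _ _ hx hy =>
    obtain ⟨m, hm⟩ := hx
    obtain ⟨n, hn⟩ := hy
    exact ⟨m + n, mul_mem_wordBall hm hn⟩
  | inv x _ hx => exact hx.imp fun n hn => inv_mem_wordBall hn

theorem growthFn_mul_le {G : Type*} [Group G] (X : Finset G) (L n : ℕ) :
    growthFn X (L * n) ≤ growthFn X n ^ L := by
  have hadd (m n : ℕ) : growthFn X (m + n) ≤ growthFn X m * growthFn X n := by
    rw [growthFn, growthFn, growthFn, ← Nat.card_prod]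
    have := (wordBall_finite X m).to_subtype
    have := (wordBall_finite X n).to_subtype
    choose a ha b hb hab using fun g : wordBall X (m + n) => wordBall_add X m n g.2
    refine Nat.card_le_card_of_injective
      (fun g => ((⟨a g, ha g⟩, ⟨b g, hb g⟩) : wordBall X m × wordBall X n)) fun g g' h => ?_
    simp only [Prod.mk.injEq, Subtype.mk.injEq] at h
    exact Subtype.ext (by rw [← hab g, ← hab g', h.1, h.2])
  induction L with
  | zero =>
    rw [zero_mul, pow_zero, growthFn]
    refine (Nat.card_mono (Set.finite_singleton (1 : G)) ?_).trans (by simp)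
    rintro g ⟨l, hl, -, rfl⟩
    simp [List.length_eq_zero_iff.1 (Nat.le_zero.1 hl)]
  | succ L ih =>
    rw [add_mul, one_mul, pow_succ]
    exact (hadd _ _).trans (Nat.mul_le_mul_right _ ih)

/-- Finite generating sets of `G` attain arbitrarily small exponential growth rates: for every `L`
there is a finite generating set of growth rate less than `2 ^ (1 / L)`. -/
def HasZeroEntropy (G : Type*) [Group G] : Prop :=
  ∀ L : ℕ, ∃ X : Finset G, Subgroup.closure (X : Set G) = ⊤ ∧ ∃ n, growthFn X (L * n) < 2 ^ n

theorem HasZeroEntropy.fg {G : Type*} [Group G] (h : HasZeroEntropy G) : Group.FG G := by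
  obtain ⟨X, hX, -⟩ := h 0
  exact Group.fg_iff.2 ⟨X, hX, X.finite_toSet⟩

theorem hasZeroEntropy_of_minGrowthRate_eq_one {G : Type*} [Group G] (hfg : Group.FG G)
    (hω : minGrowthRate G = 1) : HasZeroEntropy G := by
  intro L
  have hne : {r : ℝ | ∃ X : Finset G, Subgroup.closure (X : Set G) = ⊤ ∧
      r = growthRateX X}.Nonempty := by
    obtain ⟨S, hS, hSf⟩ := Group.fg_iff.1 hfg
    exact ⟨_, hSf.toFinset, by simpa using hS, rfl⟩
  have hlt : minGrowthRate G < (2 : ℝ) ^ ((1 : ℝ) / (L + 1)) := by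
    rw [hω]
    exact Real.one_lt_rpow (by norm_num) (by positivity)
  obtain ⟨_, ⟨X, hX, rfl⟩, hr⟩ := exists_lt_of_csInf_lt hne hlt
  obtain ⟨n, hn⟩ := exists_lt_of_ciInf_lt hr
  refine ⟨X, hX, n + 1, lt_of_le_of_lt (growthFn_mul_le X L (n + 1)) ?_⟩
  have h1 : (growthFn X (n + 1) : ℝ) < 2 ^ (((n : ℝ) + 1) / (L + 1)) := by
    have := Real.rpow_lt_rpow (by positivity) hn (z := (n : ℝ) + 1) (by positivity)
    rw [← Real.rpow_mul (by positivity), ← Real.rpow_mul (by positivity),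
      one_div_mul_cancel (by positivity), Real.rpow_one] at this
    convert this using 2
    ring
  have hpos : 1 ≤ growthFn X (n + 1) := by
    have := (wordBall_finite X (n + 1)).to_subtype
    exact Nat.card_pos_iff.2 ⟨⟨1, one_mem_wordBall X _⟩, inferInstance⟩
  refine lt_of_le_of_lt (Nat.pow_le_pow_right hpos (Nat.le_succ L)) ?_
  have h2 := pow_lt_pow_left₀ h1 (by positivity) (Nat.succ_ne_zero L)
  rw [← Real.rpow_mul_natCast (by norm_num), Nat.succ_eq_add_one, Nat.cast_add_one,
    div_mul_cancel₀ _ (by positivity)] at h2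
  exact_mod_cast h2

theorem HasZeroEntropy.of_surjective {G K : Type*} [Group G] [Group K] (h : HasZeroEntropy G)
    (f : G →* K) (hf : Function.Surjective f) : HasZeroEntropy K := by
  classical
  intro L
  obtain ⟨X, hX, n, hn⟩ := h L
  refine ⟨X.image f, ?_, n, lt_of_le_of_lt ?_ hn⟩
  · rw [Finset.coe_image, ← MonoidHom.map_closure, hX, ← MonoidHom.range_eq_map,
      MonoidHom.range_eq_top.2 hf]
  · have hsub : wordBall (X.image f) (L * n) ⊆ f '' wordBall X (L * n) := by
      rintro _ ⟨l, hl, h1, rfl⟩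
      have hlift : ∀ l : List K, (∀ x ∈ l, x ∈ X.image f ∨ x⁻¹ ∈ X.image f) →
          ∃ l' : List G, (∀ x ∈ l', x ∈ X ∨ x⁻¹ ∈ X) ∧ l'.map f = l := by
        intro l hl
        induction l with
        | nil => exact ⟨[], by simp, rfl⟩
        | cons x l ih =>
          obtain ⟨l', h1, h2⟩ := ih fun y hy => hl y (by simp [hy])
          obtain ⟨x', hx', hxx⟩ : ∃ x', (x' ∈ X ∨ x'⁻¹ ∈ X) ∧ f x' = x := by
            rcases hl x (by simp) with hx | hx
            · obtain ⟨x', h, rfl⟩ := Finset.mem_image.1 hx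
              exact ⟨x', Or.inl h, rfl⟩
            · obtain ⟨x', h, hx⟩ := Finset.mem_image.1 hx
              exact ⟨x'⁻¹, Or.inr (by simpa using h), by simp [hx]⟩
          refine ⟨x' :: l', fun y hy => ?_, by simp [hxx, h2]⟩
          rcases List.mem_cons.1 hy with rfl | hy
          exacts [hx', h1 y hy]
      obtain ⟨l', h2, rfl⟩ := hlift l h1
      exact ⟨l'.prod, ⟨l', by simpa using hl, h2, rfl⟩, map_list_prod f l'⟩
    have hfin := wordBall_finite X (L * n)
    calc growthFn (X.image f) (L * n) ≤ Nat.card (f '' wordBall X (L * n)) :=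
          Nat.card_mono (hfin.image f) hsub
      _ ≤ growthFn X (L * n) := Nat.card_image_le hfin

open Subgroup in
/-- Cosets of a subgroup of finite index are represented by short elements. -/
theorem exists_mem_wordBall_rightCoset {G : Type*} [Group G] {K : Subgroup G} (hK : K.FiniteIndex)
    {X : Finset G} (hX : closure (X : Set G) = ⊤) (g : G) :
    ∃ r ∈ wordBall X K.index, r * g⁻¹ ∈ K := by
  let B : ℕ → Set (G ⧸ K) := fun n => (fun g : G => ((g : G) : G ⧸ K)) '' wordBall X n
  have hfin : Finite (G ⧸ K) := inferInstance
  have hmono : ∀ n, B n ⊆ B (n + 1) := fun n => Set.image_mono (wordBall_mono X n.le_succ)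
  have hmono' : Monotone B := monotone_nat_of_le_succ hmono
  have hstep : ∀ n, B n = B (n + 1) → B (n + 1) = B (n + 2) := by
    intro n hn
    refine (hmono _).antisymm ?_
    rintro _ ⟨g, hg, rfl⟩
    rw [show n + 2 = 1 + (n + 1) by ring] at hg
    obtain ⟨a, ha, b, hb, rfl⟩ := wordBall_add X _ _ hg
    have hbB : ((b : G) : G ⧸ K) ∈ B (n + 1) := ⟨b, hb, rfl⟩
    rw [← hn] at hbB
    obtain ⟨b', hb', hbb⟩ := hbB
    refine ⟨a * b', add_comm 1 n ▸ mul_mem_wordBall ha hb', ?_⟩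
    have hbb' : ((b' : G) : G ⧸ K) = b := hbb
    change ((a * b' : G) : G ⧸ K) = ((a * b : G) : G ⧸ K)
    rw [QuotientGroup.eq] at hbb' ⊢
    simpa [mul_assoc] using hbb'
  have hstab : ∀ n, B n = B (n + 1) → ∀ m, B (n + m) = B n := by
    intro n hn m
    have : ∀ m, B (n + m) = B (n + m + 1) := by
      intro m
      induction m with
      | zero => exact hn
      | succ m ih => exact hstep _ ih
    induction m with
    | zero => rfl
    | succ m ih => rw [← add_assoc, ← this, ih]
  have hcard : ∀ n, (∃ k < n, B k = B (k + 1)) ∨ n + 1 ≤ (B n).ncard := by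
    intro n
    induction n with
    | zero =>
      right
      have : (B 0).Nonempty := ⟨_, 1, one_mem_wordBall X 0, rfl⟩
      have := (Set.ncard_pos (Set.toFinite _)).2 this
      omega
    | succ n ih =>
      rcases ih with ⟨k, hk, hkB⟩ | ih
      · exact Or.inl ⟨k, by omega, hkB⟩
      · by_cases h : B n = B (n + 1)
        · exact Or.inl ⟨n, by omega, h⟩
        · right
          have := Set.ncard_lt_ncard ((hmono n).ssubset_of_ne h) (Set.toFinite _)
          omega
  obtain ⟨k, hk, hkB⟩ : ∃ k < K.index, B k = B (k + 1) := by
    rcases hcard K.index with h | h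
    · exact h
    · have : (B K.index).ncard ≤ K.index := by
        rw [index, ← Set.ncard_univ]
        exact Set.ncard_le_ncard (Set.subset_univ _) (Set.toFinite _)
      omega
  obtain ⟨m, hm⟩ := mem_wordBall_of_closure hX g⁻¹
  have hg : ((g⁻¹ : G) : G ⧸ K) ∈ B k := by
    rw [← hstab k hkB m]
    exact hmono' (Nat.le_add_left m k) ⟨_, hm, rfl⟩
  obtain ⟨r, hr, hrg⟩ := hg
  refine ⟨r⁻¹, inv_mem_wordBall (wordBall_mono X hk.le hr), ?_⟩
  exact QuotientGroup.eq.1 hrg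

open Subgroup in
theorem HasZeroEntropy.subgroup {G : Type*} [Group G] (h : HasZeroEntropy G) (K : Subgroup G)
    (hK : K.FiniteIndex) : HasZeroEntropy K := by
  classical
  intro L
  obtain ⟨X, hX, n, hn⟩ := h ((2 * K.index + 1) * L)
  set d := 2 * K.index + 1
  have hfin : {k : K | (k : G) ∈ wordBall X d}.Finite :=
    (wordBall_finite X d).preimage Subtype.val_injective.injOn
  have hcosets : ∃ R : Set G, IsComplement (K : Set G) R ∧ 1 ∈ R ∧ R ⊆ wordBall X K.index := by
    choose r hr hrK using exists_mem_wordBall_rightCoset hK hX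
    let f : Quotient (QuotientGroup.rightRel K) → G := fun q =>
      if q = Quotient.mk _ 1 then 1 else r q.out
    refine ⟨Set.range f, isComplement_range_right fun q => ?_, ⟨Quotient.mk _ 1, if_pos rfl⟩, ?_⟩
    · by_cases hq : q = Quotient.mk _ 1
      · simp only [f, if_pos hq]
        exact hq.symm
      · simp only [f, if_neg hq]
        conv_rhs => rw [← q.out_eq]
        refine Quotient.sound (QuotientGroup.rightRel_apply.2 ?_)
        simpa using K.inv_mem (hrK q.out)
    · rintro _ ⟨q, rfl⟩
      by_cases hq : q = Quotient.mk _ 1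
      · simp only [f, if_pos hq]
        exact one_mem_wordBall X _
      · simp only [f, if_neg hq]
        exact hr _
  obtain ⟨R, hR, hR1, hRX⟩ := hcosets
  refine ⟨hfin.toFinset, ?_, n, lt_of_le_of_lt ?_ hn⟩
  · apply map_injective K.subtype_injective
    rw [← MonoidHom.range_eq_map, range_subtype, MonoidHom.map_closure]
    apply le_antisymm
    · rw [closure_le]
      rintro _ ⟨k, -, rfl⟩
      exact k.2
    · conv_lhs => rw [← closure_mul_image_eq hR hR1 hX]
      refine closure_mono ?_
      rintro _ ⟨_, ⟨r, hr, x, hx, rfl⟩, rfl⟩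
      refine ⟨⟨_, hR.mul_inv_toRightFun_mem (r * x)⟩, ?_, rfl⟩
      simp only [Set.Finite.coe_toFinset, Set.mem_ofPred_eq]
      have := mul_mem_wordBall (mul_mem_wordBall (hRX hr) (mem_wordBall_one hx))
        (inv_mem_wordBall (hRX (hR.toRightFun (r * x)).2))
      exact wordBall_mono X (by omega) this
  · refine (Nat.card_mono (s := Subtype.val '' wordBall hfin.toFinset (L * n))
      (t := wordBall X (d * L * n)) (wordBall_finite X _) ?_).trans_eq' ?_
    · rintro _ ⟨k, ⟨l, hl, h1, rfl⟩, rfl⟩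
      rw [SubmonoidClass.coe_list_prod]
      refine wordBall_mono X ?_ (list_prod_mem_wordBall (m := d) (l.map Subtype.val) ?_)
      · rw [List.length_map, mul_assoc]
        exact Nat.mul_le_mul_left d hl
      · intro x hx
        obtain ⟨y, hy, rfl⟩ := List.mem_map.1 hx
        rcases h1 y hy with h | h
        · simpa using h
        · simpa using inv_mem_wordBall (by simpa using h : ((y⁻¹ : K) : G) ∈ wordBall X d)
    · exact Nat.card_image_of_injective Subtype.val_injective _

section SmallRoots

open Polynomial

/-- A nonzero integer polynomial with coefficients in `{-1, 0, 1}` vanishes at `x`. -/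
def IsSmallRoot {E : Type*} [Ring E] (x : E) : Prop :=
  ∃ q : ℤ[X], q ≠ 0 ∧ (∀ i, |q.coeff i| ≤ 1) ∧ aeval x q = 0

theorem IsSmallRoot.map {E F : Type*} [Ring E] [Ring F] {x : E} (h : IsSmallRoot x)
    (f : E →+* F) : IsSmallRoot (f x) := by
  obtain ⟨q, h0, h1, h2⟩ := h
  refine ⟨q, h0, h1, ?_⟩
  rw [← RingHom.toIntAlgHom_apply f x, aeval_algHom_apply, h2, map_zero]

theorem IsSmallRoot.of_map {E F : Type*} [Ring E] [Ring F] {x : E} (f : E →+* F)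
    (hf : Function.Injective f) (h : IsSmallRoot (f x)) : IsSmallRoot x := by
  obtain ⟨q, h0, h1, h2⟩ := h
  refine ⟨q, h0, h1, hf ?_⟩
  rw [← RingHom.toIntAlgHom_apply f x, aeval_algHom_apply] at h2
  rw [map_zero]
  exact h2

theorem abs_leadingCoeff_eq_one {q : ℤ[X]} (h0 : q ≠ 0) (h1 : ∀ i, |q.coeff i| ≤ 1) :
    |q.leadingCoeff| = 1 :=
  le_antisymm (h1 _) (Int.one_le_abs (leadingCoeff_ne_zero.2 h0))

theorem IsSmallRoot.isIntegral {E : Type*} [Ring E] {x : E} (h : IsSmallRoot x) :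
    IsIntegral ℤ x := by
  obtain ⟨q, h0, h1, h2⟩ := h
  have hl := abs_leadingCoeff_eq_one h0 h1
  refine ⟨C q.leadingCoeff * q, ?_, ?_⟩
  · rw [Monic, leadingCoeff_mul, leadingCoeff_C, ← abs_mul_abs_self, hl, one_mul]
  · rw [← aeval_def, map_mul, h2, mul_zero]

theorem IsSmallRoot.norm_lt_two {z : ℂ} (h : IsSmallRoot z) : ‖z‖ < 2 := by
  obtain ⟨q, h0, h1, h2⟩ := h
  by_contra! hz
  have hl := abs_leadingCoeff_eq_one h0 h1
  rw [aeval_eq_sum_range, Finset.sum_range_succ] at h2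
  have h3 : ‖z‖ ^ q.natDegree = ‖∑ i ∈ Finset.range q.natDegree, q.coeff i • z ^ i‖ := by
    rw [eq_neg_of_add_eq_zero_left h2, norm_neg, norm_smul, norm_pow, coeff_natDegree,
      Int.norm_eq_abs, ← Int.cast_abs, hl, Int.cast_one, one_mul]
  have h4 : ‖∑ i ∈ Finset.range q.natDegree, q.coeff i • z ^ i‖ ≤
      ∑ i ∈ Finset.range q.natDegree, ‖z‖ ^ i := by
    refine (norm_sum_le _ _).trans (Finset.sum_le_sum fun i _ => ?_)
    rw [norm_smul, norm_pow, Int.norm_eq_abs, ← Int.cast_abs]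
    have : ((|q.coeff i| : ℤ) : ℝ) ≤ 1 := by exact_mod_cast h1 i
    exact mul_le_of_le_one_left (by positivity) this
  have h5 : ∑ i ∈ Finset.range q.natDegree, ‖z‖ ^ i ≤ ‖z‖ ^ q.natDegree - 1 := by
    rw [← geom_sum_mul]
    exact le_mul_of_one_le_right (by positivity) (by linarith)
  linarith

theorem finite_rat_fractionField (R K : Type*) [CommRing R] [IsDomain R] [Module.Finite ℤ R]
    [Field K] [CharZero K] [Algebra R K] [IsFractionRing R K] : Module.Finite ℚ K := by
  obtain ⟨s, hs⟩ := Module.Finite.fg_top (R := ℤ) (M := R)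
  let L : IntermediateField ℚ K := IntermediateField.adjoin ℚ (algebraMap R K '' (s : Set R))
  have hR : ∀ x : R, algebraMap R K x ∈ L := by
    intro x
    have hx : x ∈ Submodule.span ℤ (s : Set R) := hs ▸ Submodule.mem_top
    induction hx using Submodule.span_induction with
    | mem x hx => exact IntermediateField.subset_adjoin _ _ ⟨x, hx, rfl⟩
    | zero => rw [map_zero]; exact zero_mem L
    | add x y _ _ hx hy => rw [map_add]; exact add_mem hx hy
    | smul n x _ hx => rw [map_zsmul]; exact zsmul_mem hx n
  have hL : L = ⊤ := by
    refine eq_top_iff.2 fun z _ => ?_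
    obtain ⟨x, y, -, rfl⟩ := IsFractionRing.div_surjective (A := R) z
    exact div_mem (hR x) (hR y)
  have : FiniteDimensional ℚ L := by
    have : Finite (algebraMap R K '' (s : Set R)) := (s.finite_toSet.image _).to_subtype
    refine IntermediateField.finiteDimensional_adjoin ?_
    rintro _ ⟨x, -, rfl⟩
    have h : IsIntegral ℤ (algebraMap R K x) :=
      (Algebra.IsIntegral.isIntegral (R := ℤ) x).map (algebraMap R K).toIntAlgHom
    exact h.tower_top
  rw [hL] at this
  exact Module.Finite.equiv (IntermediateField.topEquiv (F := ℚ) (E := K)).toLinearEquiv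

theorem exists_finite_subgroup_of_isSmallRoot_of_charZero (R K : Type*) [CommRing R] [IsDomain R]
    [Module.Finite ℤ R] [Field K] [CharZero K] [Algebra R K] [IsFractionRing R K] :
    ∃ (k : ℕ) (F : Subgroup Rˣ), Finite F ∧ ∀ u : Rˣ,
      IsSmallRoot ((u : R) ^ k) → IsSmallRoot (((u⁻¹ : Rˣ) : R) ^ k) → u ∈ F := by
  have := finite_rat_fractionField R K
  have hK : NumberField K := ⟨⟩
  have hfin := NumberField.Embeddings.finite_of_norm_le K ℂ 2
  have h_int : ∀ x : R, IsIntegral ℤ (algebraMap R K x) := fun x =>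
    (Algebra.IsIntegral.isIntegral (R := ℤ) x).map (algebraMap R K).toIntAlgHom
  obtain ⟨k, hk0, hk⟩ : ∃ k : ℕ, 0 < k ∧ ∀ x ∈ {x : K | IsIntegral ℤ x ∧
      ∀ φ : K →+* ℂ, ‖φ x‖ ≤ 2}, ∀ φ : K →+* ℂ, 1 < ‖φ x‖ → 2 ≤ ‖φ x‖ ^ k := by
    have hev : ∀ᶠ k : ℕ in Filter.atTop, ∀ x ∈ {x : K | IsIntegral ℤ x ∧
        ∀ φ : K →+* ℂ, ‖φ x‖ ≤ 2}, ∀ φ : K →+* ℂ, 1 < ‖φ x‖ → 2 ≤ ‖φ x‖ ^ k := by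
      rw [Filter.eventually_all_finite hfin]
      intro x _
      rw [Filter.eventually_all]
      intro φ
      rw [Filter.eventually_imp_distrib_left]
      intro h
      exact (tendsto_pow_atTop_atTop_of_one_lt h).eventually_ge_atTop 2
    exact ((Filter.eventually_gt_atTop 0).and hev).exists
  let F : Subgroup Rˣ :=
    { carrier := {u | ∀ φ : K →+* ℂ, ‖φ (algebraMap R K u)‖ = 1}
      one_mem' := by simp
      mul_mem' := by
        intro a b ha hb φ
        simp [ha φ, hb φ]
      inv_mem' := by
        intro a ha φ
        have h : ‖φ (algebraMap R K a)‖ * ‖φ (algebraMap R K (a⁻¹ : Rˣ))‖ = 1 := by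
          rw [← norm_mul, ← map_mul, ← map_mul, Units.mul_inv, map_one, map_one, norm_one]
        rwa [ha φ, one_mul] at h }
  have hle : ∀ u : Rˣ, IsSmallRoot ((u : R) ^ k) → ∀ φ : K →+* ℂ,
      ‖φ (algebraMap R K u)‖ ≤ 1 := by
    intro u hu
    have hlt : ∀ φ : K →+* ℂ, ‖φ (algebraMap R K u)‖ ^ k < 2 := fun φ => by
      have := (hu.map (φ.comp (algebraMap R K))).norm_lt_two
      simpa using this
    intro φ
    by_contra! hφ
    refine absurd (hk _ ⟨h_int u, fun ψ => ?_⟩ φ hφ) (hlt φ).not_ge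
    by_contra! hψ
    have := le_self_pow₀ (by linarith : 1 ≤ ‖ψ (algebraMap R K u)‖) hk0.ne'
    linarith [hlt ψ]
  refine ⟨k, F, ?_, fun u hu hu' φ => ?_⟩
  · refine Set.Finite.to_subtype (Set.Finite.of_finite_image (f := fun u : Rˣ =>
      algebraMap R K u) (hfin.subset ?_) ?_)
    · rintro _ ⟨u, hu, rfl⟩
      exact ⟨h_int u, fun φ => (hu φ).le.trans one_le_two⟩
    · intro u _ v _ h
      exact Units.ext (IsFractionRing.injective R K h)
  · have h : ‖φ (algebraMap R K u)‖ * ‖φ (algebraMap R K (u⁻¹ : Rˣ))‖ = 1 := by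
      rw [← norm_mul, ← map_mul, ← map_mul, Units.mul_inv, map_one, map_one, norm_one]
    refine le_antisymm (hle u hu φ) ?_
    rw [← h]
    exact mul_le_of_le_one_right (norm_nonneg _) (hle u⁻¹ hu' φ)

/-- In a domain that is finite over `ℤ`, the units `u` such that some fixed power of `u` and `u⁻¹`
are roots of polynomials with coefficients in `{-1, 0, 1}` lie in a finite group. -/
theorem exists_finite_subgroup_of_isSmallRoot (R : Type*) [CommRing R] [IsDomain R]
    [Module.Finite ℤ R] : ∃ (k : ℕ) (F : Subgroup Rˣ), Finite F ∧ ∀ u : Rˣ,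
      IsSmallRoot ((u : R) ^ k) → IsSmallRoot (((u⁻¹ : Rˣ) : R) ^ k) → u ∈ F := by
  obtain ⟨p, hp⟩ := CharP.exists R
  rcases CharP.char_is_prime_or_zero R p with hpp | rfl
  · have : Finite R := by
      have := Fact.mk hpp
      let _ := ZMod.algebra R p
      have : Module.Finite (ZMod p) R := Module.Finite.of_restrictScalars_finite ℤ (ZMod p) R
      exact Module.finite_of_finite (ZMod p)
    exact ⟨0, ⊤, inferInstance, fun u _ _ => Subgroup.mem_top u⟩
  · have hchar : CharZero R := CharP.charP_to_charZero R
    have : CharZero (FractionRing R) :=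
      charZero_of_injective_algebraMap (IsFractionRing.injective R (FractionRing R))
    exact exists_finite_subgroup_of_isSmallRoot_of_charZero R (FractionRing R)

open scoped IsMulCommutative in
/-- Finitely many commuting integral elements generate a commutative ring that is finite over
`ℤ`. -/
theorem exists_finite_subalgebra_of_commuting_integral {E : Type*} [Ring E] {S : Set E}
    (hS : S.Finite)
    (hcomm : ∀ a ∈ S, ∀ b ∈ S, a * b = b * a) (h_int : ∀ a ∈ S, IsIntegral ℤ a) :
    ∃ R : Subalgebra ℤ E, S ⊆ R ∧ (∀ T : Subalgebra ℤ E, S ⊆ T → R ≤ T) ∧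
      (∀ x ∈ R, ∀ y ∈ R, x * y = y * x) ∧ Module.Finite ℤ R := by
  have := Algebra.isMulCommutative_adjoin ℤ hcomm
  refine ⟨Algebra.adjoin ℤ S, Algebra.subset_adjoin, fun T hT => Algebra.adjoin_le hT, ?_, ?_⟩
  · intro x hx y hy
    exact congrArg Subtype.val (mul_comm (⟨x, hx⟩ : Algebra.adjoin ℤ S) ⟨y, hy⟩)
  · let S' : Set (Algebra.adjoin ℤ S) := Subtype.val ⁻¹' S
    have hS' : Algebra.adjoin ℤ S' = ⊤ := Algebra.adjoin_adjoin_coe_preimage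
    have hfin : Module.Finite ℤ (Algebra.adjoin ℤ S') :=
      Algebra.finite_adjoin_of_finite_of_isIntegral
        (hS.preimage Subtype.val_injective.injOn) fun x hx =>
        (isIntegral_algHom_iff (Algebra.adjoin ℤ S).val Subtype.val_injective).1 (h_int x hx)
    rw [hS'] at hfin
    exact Module.Finite.equiv
      (Subalgebra.topEquiv (R := ℤ) (A := Algebra.adjoin ℤ S)).toLinearEquiv

/-- If the `2 ^ n` words of length `n` in `ι a * g` and `g` do not fit in a ball, then a nonzero
polynomial in `ρ g` with coefficients in `{-1, 0, 1}` kills `a`. -/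
theorem exists_small_polynomial_of_growthFn_lt {G M : Type*} [Group G] [AddCommGroup M]
    (ρ : G →* AddMonoid.End M) (ι : M → G) (hι : Function.Injective ι) (h0 : ι 0 = 1)
    (hadd : ∀ x y, ι (x + y) = ι x * ι y)
    (hconj : ∀ g x, ι (ρ g x) = g * ι x * g⁻¹) {Y : Finset G} {L n : ℕ}
    (hn : growthFn Y (L * n) < 2 ^ n) {g : G} {a : M} (hg : g ∈ wordBall Y L)
    (hag : ι a * g ∈ wordBall Y L) :
    ∃ q : ℤ[X], q ≠ 0 ∧ (∀ i, |q.coeff i| ≤ 1) ∧ aeval (ρ g) q a = 0 := by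
  let letter : Bool → G := fun b => if b then ι a * g else g
  let poly : List Bool → ℤ[X] := fun l => l.foldr (fun b p => C (if b then 1 else 0) + X * p) 0
  have hword : ∀ l : List Bool,
      (l.map letter).prod = ι (aeval (ρ g) (poly l) a) * g ^ l.length := by
    intro l
    induction l with
    | nil => simp [poly, h0]
    | cons b l ih =>
      have h1 : aeval (ρ g) (poly (b :: l)) a =
          (if b then a else 0) + ρ g (aeval (ρ g) (poly l) a) := by
        have : poly (b :: l) = C (if b then 1 else 0) + X * poly l := rfl
        rw [this, map_add, map_mul, aeval_X]
        cases b
        · simp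
        · rw [if_pos rfl, if_pos rfl, map_one, map_one]
          rfl
      rw [List.map_cons, List.prod_cons, ih, h1, hadd, hconj, List.length_cons, pow_succ']
      cases b <;> simp [letter, h0, mul_assoc]
  have hcoeff : ∀ (l : List Bool) (i : ℕ), (poly l).coeff i = 0 ∨ (poly l).coeff i = 1 := by
    intro l
    induction l with
    | nil => intro i; simp [poly]
    | cons b l ih =>
      have : poly (b :: l) = C (if b then 1 else 0) + X * poly l := rfl
      rintro (_ | i)
      · rw [this]; cases b <;> simp
      · rw [this, coeff_add, coeff_C_succ, zero_add, coeff_X_mul]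
        exact ih i
  have hinj : ∀ l l' : List Bool, l.length = l'.length → poly l = poly l' → l = l' := by
    intro l
    induction l with
    | nil => intro l' h _; exact (List.length_eq_zero_iff.1 h.symm).symm
    | cons b l ih =>
      rintro (_ | ⟨b', l'⟩) h hp
      · simp at h
      · have h1 : C (if b then 1 else 0) + X * poly l = C (if b' then 1 else 0) + X * poly l' := hp
        have hb : b = b' := by
          have h2 := congrArg (fun p => coeff p 0) h1
          simp only [coeff_add, coeff_C_zero, coeff_X_mul_zero, add_zero] at h2
          cases b <;> cases b' <;> simp at h2 ⊢
        subst hb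
        rw [add_right_inj] at h1
        rw [ih l' (by simpa using h) (mul_left_cancel₀ X_ne_zero h1)]
  obtain ⟨v, w, hvw, hne⟩ : ∃ v w : List.Vector Bool n,
      (v.toList.map letter).prod = (w.toList.map letter).prod ∧ v ≠ w := by
    by_contra! hcon
    have := (wordBall_finite Y (L * n)).to_subtype
    refine hn.not_ge ?_
    have hmem : ∀ v : List.Vector Bool n, (v.toList.map letter).prod ∈ wordBall Y (L * n) := by
      intro v
      have := list_prod_mem_wordBall (X := Y) (m := L) (v.toList.map letter) (by
        intro x hx
        obtain ⟨b, -, rfl⟩ := List.mem_map.1 hx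
        cases b
        exacts [hg, hag])
      simpa using this
    have hle := Nat.card_le_card_of_injective
      (fun v : List.Vector Bool n => (⟨_, hmem v⟩ : wordBall Y (L * n)))
      fun v w h => hcon v w (congrArg Subtype.val h)
    rw [Nat.card_eq_fintype_card, card_vector, Fintype.card_bool] at hle
    exact hle
  refine ⟨poly v.toList - poly w.toList, sub_ne_zero.2 fun h => hne ?_, fun i => ?_, ?_⟩
  · exact List.Vector.toList_injective (hinj _ _ (by simp) h)
  · rw [coeff_sub]
    rcases hcoeff v.toList i with h | h <;> rcases hcoeff w.toList i with h' | h' <;> simp [h, h']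
  · rw [hword, hword, List.Vector.toList_length, List.Vector.toList_length, mul_left_inj] at hvw
    rw [map_sub]
    exact sub_eq_zero.2 (hι hvw)

end SmallRoots

theorem exists_leftNormedCommutators_subset_wordBall (n : ℕ) : ∃ L, ∀ {G : Type*} [Group G]
    (X : Finset G), leftNormedCommutators (X : Set G) n ⊆ wordBall X L := by
  induction n with
  | zero => exact ⟨1, fun X x hx => mem_wordBall_one hx⟩
  | succ n ih =>
    obtain ⟨L, hL⟩ := ih
    refine ⟨L + 1 + L + 1, fun X => ?_⟩
    rintro _ ⟨y, hy, x, hx, rfl⟩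
    have hy' := hL X hy
    have hx' := mem_wordBall_one (Finset.mem_coe.1 hx)
    exact mul_mem_wordBall (mul_mem_wordBall (mul_mem_wordBall hy' hx') (inv_mem_wordBall hy'))
      (inv_mem_wordBall hx')

section Action

variable {G M : Type*} [Group G] [AddCommGroup M] {ρ : G →* AddMonoid.End M} {ι : M → G} {c m : ℕ}

theorem exists_finset_isSmallRoot (hG : HasZeroEntropy G) (hι : Function.Injective ι)
    (h0 : ι 0 = 1) (hadd : ∀ x y, ι (x + y) = ι x * ι y)
    (hconj : ∀ g x, ι (ρ g x) = g * ι x * g⁻¹)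
    (hm : ((⊤ : Subgroup G).lowerCentralSeries m : Set G) ⊆ Set.range ι)
    (hm' : (⊤ : Subgroup G).lowerCentralSeries m ≠ ⊥)
    (hc : ∀ y ∈ (⊤ : Subgroup G).lowerCentralSeries c, ∀ g, ρ g * ρ y = ρ y * ρ g)
    (htf : ∀ r : AddMonoid.End M, (∀ g, ρ g * r = r * ρ g) → ∀ a, a ≠ 0 → r a = 0 → r = 0)
    (k : ℕ) :
    ∃ X : Finset G, Subgroup.closure (X : Set G) = ⊤ ∧
      ∀ y ∈ leftNormedCommutators (X : Set G) c,
        IsSmallRoot (ρ y ^ k) ∧ IsSmallRoot (ρ y⁻¹ ^ k) := by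
  obtain ⟨L₁, hL₁⟩ := exists_leftNormedCommutators_subset_wordBall c
  obtain ⟨L₂, hL₂⟩ := exists_leftNormedCommutators_subset_wordBall m
  obtain ⟨X, hX, n, hn⟩ := hG (L₂ + k * L₁)
  obtain ⟨_, ha, ha1⟩ : ∃ a ∈ leftNormedCommutators (X : Set G) m, a ≠ 1 := by
    by_contra! h
    exact hm' (le_bot_iff.1 (lowerCentralSeries_le_of_leftNormedCommutators inferInstance hX m ⊥
      inferInstance fun a ha => h a ha))
  obtain ⟨b, rfl⟩ := hm (leftNormedCommutators_subset (H := ⊤) (by simp) m ha)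
  have key : ∀ y ∈ wordBall X L₁, (∀ g, ρ g * ρ y = ρ y * ρ g) → IsSmallRoot (ρ y ^ k) := by
    intro y hy hyc
    have hyk := pow_mem_wordBall hy k
    obtain ⟨q, hq0, hq1, hq⟩ := exists_small_polynomial_of_growthFn_lt ρ ι hι h0 hadd hconj hn
      (wordBall_mono X (Nat.le_add_left _ _) hyk) (mul_mem_wordBall (hL₂ X ha) hyk)
    refine ⟨q, hq0, hq1, ?_⟩
    rw [map_pow] at hq
    refine htf _ (fun g => ?_) b (fun hb => ha1 (by rw [hb, h0])) hq
    have hle : Algebra.adjoin ℤ {ρ y ^ k} ≤ Subalgebra.centralizer ℤ {ρ g} := by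
      refine Algebra.adjoin_le ?_
      rintro _ rfl
      rintro _ rfl
      exact (show Commute (ρ g) (ρ y) from hyc g).pow_right k
    exact hle (Polynomial.aeval_mem_adjoin_singleton ℤ _) _ rfl
  refine ⟨X, hX, fun y hy => ?_⟩
  have hy' := leftNormedCommutators_subset (H := ⊤) (by simp) c hy
  exact ⟨key y (hL₁ X hy) (hc y hy'), key y⁻¹ (inv_mem_wordBall (hL₁ X hy))
    (hc _ (inv_mem hy'))⟩

theorem finite_image_lowerCentralSeries (hG : HasZeroEntropy G) (hι : Function.Injective ι)
    (h0 : ι 0 = 1) (hadd : ∀ x y, ι (x + y) = ι x * ι y)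
    (hconj : ∀ g x, ι (ρ g x) = g * ι x * g⁻¹)
    (hm : ((⊤ : Subgroup G).lowerCentralSeries m : Set G) ⊆ Set.range ι)
    (hm' : (⊤ : Subgroup G).lowerCentralSeries m ≠ ⊥)
    (hc : ∀ y ∈ (⊤ : Subgroup G).lowerCentralSeries c, ∀ g, ρ g * ρ y = ρ y * ρ g)
    (htf : ∀ r : AddMonoid.End M, (∀ g, ρ g * r = r * ρ g) → ∀ a, a ≠ 0 → r a = 0 → r = 0) :
    (ρ '' ((⊤ : Subgroup G).lowerCentralSeries c)).Finite := by
  have hsmall := exists_finset_isSmallRoot hG hι h0 hadd hconj hm hm' hc htf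
  obtain ⟨X₀, hX₀, hX₀s⟩ := hsmall 1
  set C := leftNormedCommutators (X₀ : Set G) c
  have hCf : C.Finite := leftNormedCommutators_finite X₀.finite_toSet c
  have hCΓ : ∀ y ∈ C, y ∈ (⊤ : Subgroup G).lowerCentralSeries c := fun y hy =>
    leftNormedCommutators_subset (H := ⊤) (by simp) c hy
  let D : Set G := C ∪ C⁻¹
  have hDΓ : ∀ y ∈ D, y ∈ (⊤ : Subgroup G).lowerCentralSeries c := by
    rintro y (hy | hy)
    exacts [hCΓ y hy, inv_mem_iff.1 (hCΓ _ hy)]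
  obtain ⟨R, hSR, hRle, hRc, hRf⟩ := exists_finite_subalgebra_of_commuting_integral
    (S := ρ '' D) ((hCf.union hCf.inv).image ρ)
    (by
      rintro _ ⟨x, -, rfl⟩ _ ⟨y, hy, rfl⟩
      exact hc y (hDΓ y hy) x)
    (by
      rintro _ ⟨y, hy | hy, rfl⟩
      · simpa using (hX₀s y hy).1.isIntegral
      · simpa using (hX₀s _ hy).2.isIntegral)
  have hRcent : ∀ r ∈ R, ∀ g, ρ g * r = r * ρ g := fun r hr g => by
    have : R ≤ Subalgebra.centralizer ℤ {ρ g} := hRle _ (by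
      rintro _ ⟨y, hy, rfl⟩ _ rfl
      exact hc y (hDΓ y hy) g)
    exact this hr _ rfl
  let _ : CommRing R := { (inferInstance : Ring R) with
    mul_comm := fun x y => Subtype.ext (hRc x x.2 y y.2) }
  have : Nontrivial M := by
    by_contra h
    rw [not_nontrivial_iff_subsingleton] at h
    refine hm' (le_bot_iff.1 fun g hg => ?_)
    obtain ⟨b, rfl⟩ := hm hg
    rw [Subsingleton.elim b 0, h0]
    rfl
  have : NoZeroDivisors R := ⟨fun {x y} hxy => by
    by_contra! hne
    obtain ⟨b, hb⟩ : ∃ b, (y : AddMonoid.End M) b ≠ 0 := by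
      by_contra! h
      exact hne.2 (Subtype.ext (AddMonoidHom.ext h))
    refine hne.1 (Subtype.ext (htf _ (hRcent x x.2) _ hb ?_))
    exact congrArg (fun r : R => (r : AddMonoid.End M) b) hxy⟩
  have : Nontrivial R := by
    obtain ⟨b, hb⟩ := exists_ne (0 : M)
    exact ⟨0, 1, fun h => hb (congrArg (fun r : R => (r : AddMonoid.End M) b) h).symm⟩
  have : IsDomain R := NoZeroDivisors.to_isDomain R
  let φ : Rˣ →* (AddMonoid.End M)ˣ := Units.map (R.val : R →* AddMonoid.End M)
  let N : Subgroup Rˣ → Subgroup G := fun F => (F.map φ).comap ρ.toHomUnits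
  have hN : ∀ F, (N F).Normal := fun F => ⟨by
    rintro g ⟨u, hu, hug⟩ h
    refine ⟨u, hu, hug.trans (Units.ext ?_)⟩
    have : ρ h * ρ g = ρ g * ρ h := by
      have := hRcent _ (u : R).2 h
      rwa [show ((u : R) : AddMonoid.End M) = ρ g from congrArg Units.val hug] at this
    change ρ g = ρ (h * g * h⁻¹)
    rw [map_mul, map_mul, this, mul_assoc, ← map_mul, mul_inv_cancel, map_one, mul_one]⟩
  have htop : (⊤ : Subgroup G).lowerCentralSeries c ≤ N ⊤ := by
    refine lowerCentralSeries_le_of_leftNormedCommutators inferInstance hX₀ c _ (hN _) ?_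
    intro y hy
    refine ⟨⟨⟨ρ y, hSR ⟨y, Or.inl hy, rfl⟩⟩,
      ⟨ρ y⁻¹, hSR ⟨y⁻¹, Or.inr (Set.inv_mem_inv.2 hy), rfl⟩⟩, ?_, ?_⟩,
      Subgroup.mem_top _, Units.ext rfl⟩
    · exact Subtype.ext (by simp [← map_mul])
    · exact Subtype.ext (by simp [← map_mul])
  obtain ⟨k, F, hF, hkF⟩ := exists_finite_subgroup_of_isSmallRoot R
  obtain ⟨X, hX, hXs⟩ := hsmall k
  have hle : (⊤ : Subgroup G).lowerCentralSeries c ≤ N F := by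
    refine lowerCentralSeries_le_of_leftNormedCommutators inferInstance hX c _ (hN _) ?_
    intro y hy
    obtain ⟨u, -, hu⟩ := htop (leftNormedCommutators_subset (H := ⊤) (by simp) c hy)
    have h1 : ((u : R) : AddMonoid.End M) = ρ y := congrArg Units.val hu
    have h2 : (((u⁻¹ : Rˣ) : R) : AddMonoid.End M) = ρ y⁻¹ := by
      have := congrArg (fun v => ((v⁻¹ : (AddMonoid.End M)ˣ) : AddMonoid.End M)) hu
      exact this
    refine ⟨u, hkF u ?_ ?_, hu⟩
    · refine IsSmallRoot.of_map (R.val : R →+* AddMonoid.End M) Subtype.val_injective ?_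
      rw [map_pow]
      have := (hXs y hy).1
      rw [← h1] at this
      exact this
    · refine IsSmallRoot.of_map (R.val : R →+* AddMonoid.End M) Subtype.val_injective ?_
      rw [map_pow]
      have := (hXs y hy).2
      rw [← h2] at this
      exact this
  refine (Set.finite_range fun u : F => (((u : Rˣ) : R) : AddMonoid.End M)).subset ?_
  rintro _ ⟨y, hy, rfl⟩
  obtain ⟨u, hu, huy⟩ := hle hy
  exact ⟨⟨u, hu⟩, congrArg Units.val huy⟩

end Action

open Subgroup in
theorem lowerCentralSeries_top_le_of_map {G : Type*} [Group G] {H M : Subgroup G} {n : ℕ}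
    (h : H.lowerCentralSeries n ≤ M) :
    (⊤ : Subgroup H).lowerCentralSeries n ≤ M.subgroupOf H := by
  rw [subgroupOf, ← map_le_iff_le_comap, map_lowerCentralSeries, ← MonoidHom.range_eq_map,
    range_subtype]
  exact h

open Subgroup in
open scoped IsMulCommutative in
/-- If all proper quotients of `G` are virtually nilpotent but `G` is not, then some finite index
subgroup of `G` acts on `A` through a group of smaller nilpotency class. -/
theorem exists_finiteIndex_lowerCentralSeries_le_centralizer {G : Type*} [Group G]
    (hG : HasZeroEntropy G) (A : Subgroup G) (hA : A.Normal) [IsMulCommutative A] {c m : ℕ}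
    (hm : (⊤ : Subgroup G).lowerCentralSeries m ≤ A)
    (hc : (⊤ : Subgroup G).lowerCentralSeries (c + 1) ≤ centralizer A)
    (hbot : ¬ IsVirtNilpotentMod (⊥ : Subgroup G))
    (hlt : ∀ M : Subgroup G, M.Normal → ⊥ < M → IsVirtNilpotentMod M) :
    ∃ K : Subgroup G, K.FiniteIndex ∧ K.lowerCentralSeries c ≤ centralizer A := by
  let ρ : G →* AddMonoid.End (Additive A) :=
    { toFun := fun g => MonoidHom.toAdditive (MulAut.conjNormal g : MulAut A).toMonoidHom
      map_one' := by rw [map_one]; rfl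
      map_mul' := fun g h => by rw [map_mul]; rfl }
  have hρ : ∀ g (a : A), ((ρ g (Additive.ofMul a)).toMul : G) = g * a * g⁻¹ := fun g a =>
    MulAut.conjNormal_apply g a
  have hρ1 : ∀ g h, ρ g = ρ h → g⁻¹ * h ∈ centralizer (A : Set G) := by
    intro g h hgh
    rw [mem_centralizer_iff]
    intro a ha
    have := hρ g ⟨a, ha⟩
    rw [hgh, hρ] at this
    have h2 : h * a = g * a * g⁻¹ * h := by rw [← this]; simp
    rw [mul_assoc, h2]
    group
  have hfin : (ρ '' ((⊤ : Subgroup G).lowerCentralSeries c)).Finite := by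
    refine finite_image_lowerCentralSeries (m := m) (ι := fun a : Additive A => (a.toMul : G)) hG
      (fun a b h => Subtype.ext h) rfl (fun _ _ => rfl) (fun g a => hρ g a.toMul)
      (fun g hg => ⟨Additive.ofMul ⟨g, hm hg⟩, rfl⟩) ?_ ?_ ?_
    · intro h
      exact hbot ⟨⊤, inferInstance, inferInstance, m, h.le⟩
    · intro y hy g
      rw [← map_mul, ← map_mul]
      have := hc (commutator_mem_commutator hy (mem_top g))
      refine AddMonoidHom.ext fun a => Subtype.ext ?_
      have h1 := hρ (g * y) a.toMul
      have h2 := hρ (y * g) a.toMul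
      refine h1.trans (Eq.trans ?_ h2.symm)
      have ha := mem_centralizer_iff.1 this _ ((ρ (g * y) a).toMul : A).2
      have h1' : ((ρ (g * y) a).toMul : G) = g * y * (a.toMul : G) * (g * y)⁻¹ := h1
      rw [h1', commutatorElement_def] at ha
      have h3 : y * g * (a.toMul : G) * (y * g)⁻¹ =
        (y * g * y⁻¹ * g⁻¹) * (g * y * (a.toMul : G) * (g * y)⁻¹) * (y * g * y⁻¹ * g⁻¹)⁻¹ := by
        group
      rw [h3, ← ha, mul_inv_cancel_right]
    · intro r hr a ha hra
      by_contra hr0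
      let f : A →* A := MonoidHom.toAdditive.symm r
      have hf : ∀ (g : G) (a : A), f (MulAut.conjNormal g a) = MulAut.conjNormal g (f a) :=
        fun g a => (congrArg (fun s : AddMonoid.End (Additive A) => s (Additive.ofMul a))
          (hr g)).symm
      have hmem : ∀ {S : Subgroup A}, (∀ (g : G), ∀ a ∈ S, MulAut.conjNormal g a ∈ S) →
          ∀ a ∈ S, a ≠ 1 → IsVirtNilpotentMod (S.map A.subtype) := by
        intro S hS a ha ha1
        refine hlt _ ⟨?_⟩ (bot_lt_iff_ne_bot.2 fun h => ha1 ?_)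
        · rintro _ ⟨b, hb, rfl⟩ g
          exact ⟨_, hS g b hb, MulAut.conjNormal_apply g b⟩
        · rw [map_eq_bot_iff_of_injective _ A.subtype_injective] at h
          rwa [h, mem_bot] at ha
      refine hbot (isVirtNilpotentMod_bot_of_ker_of_range hA f hf (hmem ?_ a.toMul hra ha) ?_)
      · intro g b hb
        rw [MonoidHom.mem_ker] at hb ⊢
        rw [hf, hb, map_one]
      · obtain ⟨b, hb⟩ : ∃ b, r b ≠ 0 := by
          by_contra! h
          exact hr0 (AddMonoidHom.ext h)
        refine hmem ?_ (f b.toMul) ⟨_, rfl⟩ hb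
        rintro g _ ⟨b, rfl⟩
        exact ⟨_, hf g b⟩
  let π := QuotientGroup.mk' (centralizer (A : Set G))
  have hπ : Function.Surjective π := QuotientGroup.mk'_surjective _
  have hfin' : ((⊤ : Subgroup (G ⧸ centralizer (A : Set G))).lowerCentralSeries c :
      Set (G ⧸ centralizer (A : Set G))).Finite := by
    rw [← map_top_of_surjective π hπ, ← map_lowerCentralSeries, coe_map]
    have := hfin.to_subtype
    let Γ : Set G := (⊤ : Subgroup G).lowerCentralSeries c
    choose s hs hsρ using fun x : ρ '' Γ => x.2
    refine (Set.finite_range fun x => π (s x)).subset ?_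
    rintro _ ⟨y, hy, rfl⟩
    exact ⟨⟨ρ y, y, hy, rfl⟩, QuotientGroup.eq.2 (hρ1 _ _ (hsρ ⟨ρ y, y, hy, rfl⟩))⟩
  obtain ⟨K, -, hK, hKc⟩ := exists_finiteIndex_lowerCentralSeries_eq_bot
    (hG.of_surjective π hπ).fg c hfin'
  refine ⟨K.comap π, ⟨?_⟩, ?_⟩
  · rw [index_comap_of_surjective _ hπ]
    exact hK.index_ne_zero
  · refine (lowerCentralSeries_comap_le π K c).trans ?_
    rw [hKc, MonoidHom.comap_bot, QuotientGroup.ker_mk']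

universe u

open Subgroup in
/-- The induction is on the nilpotency class `c` of the group through which `G` acts on `A`. -/
theorem isVirtNilpotentMod_bot_of_normal_abelian (c : ℕ) : ∀ {G : Type u} [Group G],
    HasZeroEntropy G → ∀ A : Subgroup G, A.Normal → IsMulCommutative A → ∀ m : ℕ,
    (⊤ : Subgroup G).lowerCentralSeries m ≤ A →
    (⊤ : Subgroup G).lowerCentralSeries c ≤ centralizer A →
    IsVirtNilpotentMod (⊥ : Subgroup G) := by
  induction c with
  | zero =>
    intro G _ hG A _ _ m hm hc
    refine ⟨⊤, inferInstance, inferInstance, m + 1, ?_⟩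
    rw [Subgroup.lowerCentralSeries_succ, le_bot_iff, commutator_eq_bot_iff_le_centralizer]
    refine hm.trans ?_
    rw [le_centralizer_iff]
    exact hc
  | succ c ih =>
    intro G _ hG A hA hAc m hm hc
    by_contra hbot
    obtain ⟨N, hN, hNv, hlt⟩ := exists_just_non_virtNilpotent hG.fg hbot
    let π := QuotientGroup.mk' N
    have hπ : Function.Surjective π := QuotientGroup.mk'_surjective _
    have hG' := hG.of_surjective π hπ
    have hA' : (A.map π).Normal := hA.map π hπ
    have hAc' : IsMulCommutative (A.map π) := inferInstance
    have htop : ∀ n, (⊤ : Subgroup (G ⧸ N)).lowerCentralSeries n =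
        ((⊤ : Subgroup G).lowerCentralSeries n).map π := fun n => by
      rw [map_lowerCentralSeries, map_top_of_surjective π hπ]
    have hbot' : ¬ IsVirtNilpotentMod (⊥ : Subgroup (G ⧸ N)) := fun h => hNv (by
      have := h.comap π
      rwa [MonoidHom.comap_bot, QuotientGroup.ker_mk'] at this)
    obtain ⟨K, hK, hKc⟩ := exists_finiteIndex_lowerCentralSeries_le_centralizer hG' (A.map π) hA'
      (c := c) (m := m) (by rw [htop]; exact map_mono hm)
      (by
        rw [htop]
        refine (map_mono hc).trans ?_
        rintro _ ⟨g, hg, rfl⟩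
        rw [mem_centralizer_iff]
        rintro _ ⟨a, ha, rfl⟩
        rw [← map_mul, ← map_mul, mem_centralizer_iff.1 hg a ha])
      hbot' (by
        intro M hM hM0
        have := (hlt (M.comap π) inferInstance (lt_of_le_of_ne ?_ ?_)).map hπ
        · rwa [map_comap_eq_self_of_surjective hπ] at this
        · exact QuotientGroup.le_comap_mk' N M
        · rintro h
          refine hM0.ne' ?_
          rw [← map_comap_eq_self_of_surjective hπ M, ← h]
          exact QuotientGroup.map_mk'_self N)
    refine hbot' (isVirtNilpotentMod_bot_of_subgroup K hK
      (ih (hG'.subgroup K hK) ((A.map π).subgroupOf K) inferInstance inferInstance m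
        (lowerCentralSeries_top_le_of_map ?_) ?_))
    · refine (lowerCentralSeries_mono_of_le le_top m).trans ?_
      rw [htop]
      exact map_mono hm
    · refine (lowerCentralSeries_top_le_of_map hKc).trans fun g hg => ?_
      rw [mem_centralizer_iff]
      intro a ha
      exact Subtype.ext (mem_centralizer_iff.1 hg a ha)

open Subgroup in
theorem isVirtNilpotentMod_bot_of_derivedSeries (n : ℕ) : ∀ {G : Type u} [Group G],
    HasZeroEntropy G → derivedSeries G n = ⊥ → IsVirtNilpotentMod (⊥ : Subgroup G) := by
  induction n with
  | zero =>
    intro G _ _ h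
    exact ⟨⊤, inferInstance, inferInstance, 0, h.le⟩
  | succ n ih =>
    intro G _ hG h
    set A := derivedSeries G n
    have hA : A.Normal := inferInstance
    have hAc : A ≤ centralizer A := by
      rwa [derivedSeries_succ, commutator_eq_bot_iff_le_centralizer] at h
    have hAm : IsMulCommutative A := le_centralizer_iff_isMulCommutative.1 hAc
    have hπ := QuotientGroup.mk'_surjective A
    have hq := (ih (hG.of_surjective _ hπ) (by
      rw [← map_derivedSeries_eq hπ, QuotientGroup.map_mk'_self])).comap (QuotientGroup.mk' A)
    rw [MonoidHom.comap_bot, QuotientGroup.ker_mk'] at hq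
    obtain ⟨K, -, hK, m, hKm⟩ := hq
    have hm := lowerCentralSeries_top_le_of_map hKm
    exact isVirtNilpotentMod_bot_of_subgroup K hK
      (isVirtNilpotentMod_bot_of_normal_abelian m (hG.subgroup K hK) (A.subgroupOf K)
        inferInstance inferInstance m hm
        (hm.trans (le_centralizer_iff_isMulCommutative.2 inferInstance)))

/-- **Theorem 3.1 (Osin, [Osin]).** A finitely generated solvable group of zero entropy
(`ω(G) = 1`) contains a nilpotent subgroup of finite index. -/
theorem fg_solvable_zero_entropy_virtually_nilpotent
    {G : Type*} [Group G] (hfg : Group.FG G) (hsolv : IsSolvable G)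
    (hω : minGrowthRate G = 1) :
    ∃ H : Subgroup G, H.FiniteIndex ∧ Group.IsNilpotent H := by
  obtain ⟨n, hn⟩ := hsolv.solvable
  obtain ⟨H, -, hH, m, hm⟩ := isVirtNilpotentMod_bot_of_derivedSeries n
    (hasZeroEntropy_of_minGrowthRate_eq_one hfg hω) hn
  exact ⟨H, hH, (Subgroup.isNilpotent_iff_lowerCentralSeries H).2 ⟨m, le_bot_iff.1 hm⟩⟩
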